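/- In a unit-capacity network (u ≡ 1), an s-t-flow x is strictly reroutable if and only if ∑_{a∈C} (1 − x(a)) ≥ 1 for every t-separating cut C ∈ 𝒞. -/

import Mathlib

open scoped BigOperators

variable {V A : Type}

/-- `IsWalk tl hd v w L`: the list of arcs `L` forms a walk from `v` to `w`
in the digraph whose arcs `a` go from `tl a` to `hd a`. -/
def IsWalk (tl hd : A → V) : V → V → List A → Prop
  | v, w, [] => v = w
  | v, w, a :: L => tl a = v ∧ IsWalk tl hd (hd a) w L

/-- A simple path from `v` to `w`: a walk visiting no vertex twice. -/
def IsPath (tl hd : A → V) (v w : V) (L : List A) : Prop :=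
  IsWalk tl hd v w L ∧ (v :: L.map hd).Nodup

/-- `Before L b a`: the list `L` traverses `b` (strictly) before `a`. -/
def Before (L : List A) (b a : A) : Prop :=
  ∃ l₁ l₂ l₃ : List A, L = l₁ ++ b :: (l₂ ++ a :: l₃)

/-- Sum of a path-flow over a set of paths. -/
noncomputable def sumOver (x : List A → ℝ) (S : Set (List A)) : ℝ :=
  ∑ᶠ P ∈ S, x P

/-- Flow value `x(a)` on an arc `a`: total flow on `s`-`t`-paths through `a`. -/
noncomputable def arcFlow (tl hd : A → V) (s t : V) (x : List A → ℝ) (a : A) : ℝ :=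
  sumOver x {P | IsPath tl hd s t P ∧ a ∈ P}

/-- The value of a flow: total flow on all `s`-`t`-paths. -/
noncomputable def flowVal (tl hd : A → V) (s t : V) (x : List A → ℝ) : ℝ :=
  sumOver x {P | IsPath tl hd s t P}

/-- An `s`-`t`-(path-)flow: nonnegative, supported on simple `s`-`t`-paths,
respecting the arc capacities `u`. -/
def IsFlow (tl hd : A → V) (s t : V) (u : A → ℝ) (x : List A → ℝ) : Prop :=
  (∀ P, 0 ≤ x P) ∧ (∀ P, ¬ IsPath tl hd s t P → x P = 0) ∧
    ∀ a : A, arcFlow tl hd s t x a ≤ u a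

/-- Available capacity `ū_{x,b}(a)` of arc `a` after failure of arc `b`:
`u(a)` minus the flow on paths through `a` that do not traverse `b` before `a`. -/
noncomputable def availCap (tl hd : A → V) (s t : V) (u : A → ℝ) (x : List A → ℝ)
    (b a : A) : ℝ :=
  u a - sumOver x {P | IsPath tl hd s t P ∧ a ∈ P ∧ ¬ Before P b a}

/-- Arc flow of a rerouting flow `y` for failing arc `b`: `y` lives on
`tl b`-`t`-paths avoiding `b`. -/
noncomputable def reArcFlow (tl hd : A → V) (t : V) (b : A) (y : List A → ℝ) (a : A) : ℝ :=
  sumOver y {Q | IsPath tl hd (tl b) t Q ∧ b ∉ Q ∧ a ∈ Q}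

/-- Value of a rerouting flow `y` for failing arc `b`. -/
noncomputable def reVal (tl hd : A → V) (t : V) (b : A) (y : List A → ℝ) : ℝ :=
  sumOver y {Q | IsPath tl hd (tl b) t Q ∧ b ∉ Q}

/-- `y` is a rerouting of `x` for the failing arc `b`: a `tl b`-`t`-flow of value
`x(b)` in `(V, A ∖ {b})` with capacities `ū_{x,b}`. -/
def IsRerouting (tl hd : A → V) (s t : V) (u : A → ℝ) (x : List A → ℝ) (b : A)
    (y : List A → ℝ) : Prop :=
  (∀ Q, 0 ≤ y Q) ∧
  (∀ Q, ¬ (IsPath tl hd (tl b) t Q ∧ b ∉ Q) → y Q = 0) ∧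
  (∀ a : A, a ≠ b → reArcFlow tl hd t b y a ≤ availCap tl hd s t u x b a) ∧
  reVal tl hd t b y = arcFlow tl hd s t x b

/-- `y` is a strict rerouting of `x` for the failing arc `b`: a `tl b`-`t`-flow
of value `x(b)` in `(V, A ∖ {b})` with `y(a) ≤ u(a) - x(a)` for all `a ≠ b`. -/
def IsStrictRerouting (tl hd : A → V) (s t : V) (u : A → ℝ) (x : List A → ℝ) (b : A)
    (y : List A → ℝ) : Prop :=
  (∀ Q, 0 ≤ y Q) ∧
  (∀ Q, ¬ (IsPath tl hd (tl b) t Q ∧ b ∉ Q) → y Q = 0) ∧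
  (∀ a : A, a ≠ b → reArcFlow tl hd t b y a ≤ u a - arcFlow tl hd s t x a) ∧
  reVal tl hd t b y = arcFlow tl hd s t x b

/-- `x` is reroutable: a rerouting exists for every failing arc. -/
def Reroutable (tl hd : A → V) (s t : V) (u : A → ℝ) (x : List A → ℝ) : Prop :=
  ∀ b : A, ∃ y : List A → ℝ, IsRerouting tl hd s t u x b y

/-- `x` is strictly reroutable: a strict rerouting exists for every failing arc. -/
def StrictlyReroutable (tl hd : A → V) (s t : V) (u : A → ℝ) (x : List A → ℝ) : Prop :=
  ∀ b : A, ∃ y : List A → ℝ, IsStrictRerouting tl hd s t u x b y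

/-- `δ⁺(S)`: the set of arcs with tail in `S` and head outside `S`. -/
def outCut [Fintype A] [DecidableEq V] (tl hd : A → V) (S : Finset V) : Finset A :=
  Finset.univ.filter fun a => tl a ∈ S ∧ hd a ∉ S

theorem aux_path_suffix (tl hd : A → V) (w v : V) : ∀ (P : List A) (u : V), IsPath tl hd u w P →
    v ∈ u :: P.map hd → ∃ Q, Q.Sublist P ∧ IsPath tl hd v w Q := by
  intro P
  induction P with
  | nil =>
    intro u h hv
    simp at hv
    subst hv
    exact ⟨[], List.Sublist.refl _, h⟩
  | cons a P ih =>
    intro u h hv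
    rcases List.mem_cons.1 hv with rfl | hv
    · exact ⟨_, List.Sublist.refl _, h⟩
    · obtain ⟨⟨h1, h2⟩, h3⟩ := h
      have h4 : IsPath tl hd (hd a) w P := ⟨h2, (List.nodup_cons.1 h3).2⟩
      obtain ⟨Q, hQ, hp⟩ := ih (hd a) h4 (by simpa using hv)
      exact ⟨Q, hQ.trans (List.sublist_cons_self _ _), hp⟩

theorem aux_walk_path (tl hd : A → V) (w : V) : ∀ (L : List A) (u : V), IsWalk tl hd u w L →
    ∃ Q, Q.Sublist L ∧ IsPath tl hd u w Q := by
  intro L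
  induction L with
  | nil =>
    intro u h
    exact ⟨[], List.Sublist.refl _, h, by simp⟩
  | cons a L ih =>
    intro u h
    obtain ⟨h1, h2⟩ := h
    obtain ⟨P, hP, hp⟩ := ih (hd a) h2
    by_cases hu : u ∈ hd a :: P.map hd
    · obtain ⟨Q, hQ, hq⟩ := aux_path_suffix tl hd w u P (hd a) hp hu
      exact ⟨Q, (hQ.trans hP).trans (List.sublist_cons_self _ _), hq⟩
    · refine ⟨a :: P, hP.cons_cons a, ⟨h1, hp.1⟩, ?_⟩
      rw [List.nodup_cons]
      exact ⟨by simpa using hu, by simpa using hp.2⟩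

theorem aux_walk_snoc (tl hd : A → V) (a : A) : ∀ (L : List A) (u : V), IsWalk tl hd u (tl a) L →
    IsWalk tl hd u (hd a) (L ++ [a]) := by
  intro L
  induction L with
  | nil => intro u h; exact ⟨h.symm, rfl⟩
  | cons b L ih => intro u h; exact ⟨h.1, ih _ h.2⟩

theorem aux_walk_cross (tl hd : A → V) (w : V) (S : Set V) (hw : w ∉ S) :
    ∀ (L : List A) (u : V), u ∈ S → IsWalk tl hd u w L → ∃ a ∈ L, tl a ∈ S ∧ hd a ∉ S := by
  intro L
  induction L with
  | nil => intro u hu h; exact absurd (h ▸ hu) hw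
  | cons b L ih =>
    intro u hu h
    obtain ⟨h1, h2⟩ := h
    by_cases hb : hd b ∈ S
    · obtain ⟨a, ha, h⟩ := ih _ hb h2
      exact ⟨a, by simp [ha], h⟩
    · exact ⟨b, by simp, h1 ▸ hu, hb⟩

theorem aux_path_nodup {tl hd : A → V} {v w : V} {L : List A} (h : IsPath tl hd v w L) :
    L.Nodup := List.Nodup.of_map hd (List.nodup_cons.1 h.2).2

theorem aux_finite [Fintype A] [DecidableEq A] (tl hd : A → V) (v w : V) :
    {Q | IsPath tl hd v w Q}.Finite := by
  have : {Q : List A | Q.Nodup}.Finite := by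
    have hf : Finite {Q : List A // Q.Nodup} := Finite.of_fintype _
    exact Set.finite_coe_iff.1 hf
  exact this.subset fun Q hQ => aux_path_nodup hQ

theorem aux_sumOver [Fintype A] [DecidableEq A] (tl hd : A → V) (v w : V) (y : List A → ℝ)
    (p : List A → Prop) [DecidablePred p] :
    sumOver y {Q | IsPath tl hd v w Q ∧ p Q} =
      ∑ Q ∈ (aux_finite tl hd v w).toFinset, if p Q then y Q else 0 := by
  unfold sumOver
  rw [← Finset.sum_filter]
  apply finsum_mem_eq_sum_of_inter_support_eq
  congr 1
  ext Q
  simp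

theorem aux_pot [Fintype A] [DecidableEq A] (tl hd : A → V) (v t : V) (l : A → ℝ)
    (hl : ∀ a, 0 ≤ l a) (D : ℝ) (hD : 0 ≤ D)
    (h : ∀ Q, IsPath tl hd v t Q → D ≤ (Q.map l).sum) :
    ∃ p : V → ℝ, p v ≤ 0 ∧ D ≤ p t ∧ ∀ a, p (hd a) ≤ p (tl a) + l a := by
  have hnn : ∀ Q : List A, 0 ≤ (Q.map l).sum := fun Q => List.sum_nonneg (by
    intro r hr; obtain ⟨a, -, rfl⟩ := List.mem_map.1 hr; exact hl a)
  let W : V → Set ℝ := fun w => insert D {r | ∃ Q, IsWalk tl hd v w Q ∧ r = (Q.map l).sum}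
  have hb : ∀ w, BddBelow (W w) := fun w => ⟨0, by
    rintro r (rfl | ⟨Q, -, rfl⟩)
    · exact hD
    · exact hnn Q⟩
  have hne : ∀ w, (W w).Nonempty := fun w => ⟨D, Set.mem_insert _ _⟩
  refine ⟨fun w => sInf (W w), ?_, ?_, ?_⟩
  · exact csInf_le (hb v) (Or.inr ⟨[], rfl, by simp⟩)
  · apply le_csInf (hne t)
    rintro r (rfl | ⟨Q, hQ, rfl⟩)
    · exact le_rfl
    · obtain ⟨P, hP, hp⟩ := aux_walk_path tl hd t Q v hQ
      refine (h P hp).trans ?_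
      exact (hP.map l).sum_le_sum (by
        intro r hr; obtain ⟨a, -, rfl⟩ := List.mem_map.1 hr; exact hl a)
  · intro a
    rw [← sub_le_iff_le_add]
    apply le_csInf (hne _)
    rintro r (rfl | ⟨Q, hQ, rfl⟩)
    · have := csInf_le (hb (hd a)) (Set.mem_insert _ _)
      have := hl a
      linarith
    · rw [sub_le_iff_le_add]
      refine csInf_le (hb (hd a)) (Or.inr ⟨Q ++ [a], aux_walk_snoc tl hd a Q v hQ, by simp⟩)

theorem aux_cut [Fintype V] [DecidableEq V] [Fintype A] (tl hd : A → V) (v t : V)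
    (l c : A → ℝ) (hl : ∀ a, 0 ≤ l a) (hc : ∀ a, 0 ≤ c a) (D val : ℝ) (hD : 0 ≤ D)
    (hcut : ∀ S : Finset V, v ∈ S → t ∉ S → val ≤ ∑ a ∈ outCut tl hd S, c a)
    (p : V → ℝ) (hpv : p v ≤ 0) (hpt : D ≤ p t) (hp : ∀ a, p (hd a) ≤ p (tl a) + l a) :
    val * D ≤ ∑ a, c a * l a := by
  classical
  let F : A → ℝ → ℝ := fun a => (Set.Ioc (p (tl a)) (p (hd a))).indicator (fun _ => c a)
  have hint : ∀ a, MeasureTheory.IntegrableOn (F a) (Set.Ioc 0 D) := by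
    intro a
    apply MeasureTheory.IntegrableOn.indicator _ measurableSet_Ioc
    exact MeasureTheory.integrableOn_const (by simp)
  have h1 : ∫ θ in Set.Ioc 0 D, val ≤ ∫ θ in Set.Ioc 0 D, ∑ a, F a θ := by
    apply MeasureTheory.setIntegral_mono_on
    · exact MeasureTheory.integrableOn_const (by simp)
    · exact MeasureTheory.integrable_finsetSum _ fun a _ => hint a
    · exact measurableSet_Ioc
    · intro θ hθ
      refine (hcut (Finset.univ.filter fun w => p w < θ) ?_ ?_).trans (le_of_eq ?_)
      · simp; linarith [hθ.1]
      · simp; linarith [hθ.2]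
      · unfold outCut
        rw [Finset.sum_filter]
        apply Finset.sum_congr rfl
        intro a _
        simp [F, Set.indicator]
  rw [MeasureTheory.integral_finsetSum _ fun a _ => hint a] at h1
  have h2 : ∫ θ in Set.Ioc 0 D, val = val * D := by
    simp [hD, mul_comm]
  rw [h2] at h1
  refine h1.trans (Finset.sum_le_sum fun a _ => ?_)
  have h3 : ∫ θ in Set.Ioc 0 D, F a θ ≤ ∫ θ, F a θ := by
    apply MeasureTheory.setIntegral_le_integral
    · rw [MeasureTheory.integrable_indicator_iff measurableSet_Ioc]
      exact MeasureTheory.integrableOn_const (by simp)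
    · exact Filter.Eventually.of_forall fun θ => Set.indicator_nonneg (fun _ _ => hc a) θ
  refine h3.trans ?_
  rw [MeasureTheory.integral_indicator measurableSet_Ioc]
  simp only [MeasureTheory.setIntegral_const, smul_eq_mul]
  rw [mul_comm]
  apply mul_le_mul_of_nonneg_left _ (hc a)
  rw [Real.volume_real_Ioc]
  exact max_le (by linarith [hp a]) (hl a)

theorem aux_mfmc [Fintype V] [DecidableEq V] [Fintype A] [DecidableEq A] (tl hd : A → V) (v t : V)
    (c : A → ℝ) (hc : ∀ a, 0 ≤ c a) (val : ℝ) (hval : 0 ≤ val)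
    (hcut : ∀ S : Finset V, v ∈ S → t ∉ S → val ≤ ∑ a ∈ outCut tl hd S, c a) :
    ∃ y : List A → ℝ, (∀ Q, 0 ≤ y Q) ∧ (∀ Q, ¬ IsPath tl hd v t Q → y Q = 0) ∧
      (∀ a, (∑ Q ∈ (aux_finite tl hd v t).toFinset, if a ∈ Q then y Q else 0) ≤ c a) ∧
      ∑ Q ∈ (aux_finite tl hd v t).toFinset, y Q = val := by
  classical
  rcases hval.eq_or_lt with rfl | hval
  · exact ⟨fun _ => 0, by simp, by simp, by simpa using hc, by simp⟩
  set N := (aux_finite tl hd v t).toFinset with hN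
  have hmem : ∀ Q, Q ∈ N ↔ IsPath tl hd v t Q := by simp [hN]
  let G : (N → ℝ) → A → ℝ := fun w a => val * ∑ Q : N, if a ∈ Q.1 then w Q else 0
  by_cases hdis : Disjoint {z : A → ℝ | z ≤ c} (G '' stdSimplex ℝ N)
  · exfalso
    have hlin : IsLinearMap ℝ G := by
      constructor
      · intro w w'
        ext a
        simp only [G, Pi.add_apply, ← mul_add, ← Finset.sum_add_distrib]
        congr 1
        apply Finset.sum_congr rfl
        intro Q _
        split_ifs <;> simp
      · intro r w
        ext a
        simp only [G, Pi.smul_apply, smul_eq_mul]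
        rw [mul_left_comm, Finset.mul_sum Finset.univ _ r]
        congr 1
        apply Finset.sum_congr rfl
        intro Q _
        split_ifs <;> simp
    have hcont : Continuous G := by
      apply continuous_pi
      intro a
      apply Continuous.mul continuous_const
      apply continuous_finsetSum
      intro Q _
      split_ifs
      · exact continuous_apply Q
      · exact continuous_const
    obtain ⟨f, u, u', hf1, huu, hf2⟩ := geometric_hahn_banach_closed_compact
      (convex_Iic (𝕜 := ℝ) c) isClosed_Iic ((convex_stdSimplex ℝ N).is_linear_image hlin)
      ((isCompact_stdSimplex ℝ N).image hcont) hdis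
    let l : A → ℝ := fun a => f (Pi.single a 1)
    have hfl : ∀ z, f z = ∑ a, z a * l a := by
      intro z
      conv_lhs => rw [pi_eq_sum_univ' z, map_sum]
      apply Finset.sum_congr rfl
      intro a _
      rw [map_smul, smul_eq_mul]
    have hl : ∀ a, 0 ≤ l a := by
      intro a
      by_contra hneg
      push Not at hneg
      have hfc : f c < u := hf1 c (Set.mem_Iic.2 le_rfl)
      have hk : 0 ≤ (u - f c) / (- l a) := div_nonneg (by linarith) (by linarith)
      have := hf1 (c - ((u - f c) / (- l a)) • Pi.single a 1) (by
        intro j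
        have : 0 ≤ (Pi.single a 1 : A → ℝ) j := by
          rw [Pi.single_apply]; split_ifs <;> norm_num
        have := mul_nonneg hk this
        simp only [Pi.sub_apply, Pi.smul_apply, smul_eq_mul]
        linarith)
      rw [map_sub, map_smul, smul_eq_mul] at this
      change f c - (u - f c) / (- l a) * l a < u at this
      have h5 : (u - f c) / (- l a) * l a = -(u - f c) := by
        have hne : l a ≠ 0 := hneg.ne
        field_simp
      linarith
    have hcl : ∑ a, c a * l a < u := by
      rw [← hfl]; exact hf1 c (Set.mem_Iic.2 le_rfl)
    have hu : 0 < u := lt_of_le_of_lt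
      (Finset.sum_nonneg fun a _ => mul_nonneg (hc a) (hl a)) hcl
    have hD : 0 ≤ u / val := by positivity
    obtain ⟨p, hp1, hp2, hp3⟩ := aux_pot tl hd v t l hl (u / val) hD (by
      intro Q hQ
      have h1 := hf2 (G (Pi.single ⟨Q, (hmem Q).2 hQ⟩ 1)) ⟨_, single_mem_stdSimplex ℝ _, rfl⟩
      have h2 : f (G (Pi.single ⟨Q, (hmem Q).2 hQ⟩ 1)) = val * (Q.map l).sum := by
        rw [hfl, ← List.sum_toFinset l (aux_path_nodup hQ), Finset.mul_sum]
        rw [← Finset.sum_subset (Finset.subset_univ Q.toFinset)]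
        · apply Finset.sum_congr rfl
          intro a ha
          have ha : a ∈ Q := by simpa using ha
          congr 1
          simp only [G]
          rw [Finset.sum_eq_single ⟨Q, (hmem Q).2 hQ⟩]
          · simp [ha]
          · intro R _ hR
            simp [hR]
          · simp
        · intro a _ ha
          have ha : a ∉ Q := by simpa using ha
          simp only [G]
          rw [Finset.sum_eq_zero]
          · simp
          · intro R _
            split_ifs with h
            · rw [Pi.single_apply, if_neg]
              rintro rfl
              exact ha h
            · rfl
      rw [div_le_iff₀ hval]
      linarith)
    have := aux_cut tl hd v t l c hl hc (u / val) val hD hcut p hp1 hp2 hp3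
    rw [mul_div_cancel₀ _ hval.ne'] at this
    linarith
  · rw [Set.not_disjoint_iff] at hdis
    obtain ⟨z, hz, w, hw, rfl⟩ := hdis
    refine ⟨fun Q => if h : Q ∈ N then val * w ⟨Q, h⟩ else 0, ?_, ?_, ?_, ?_⟩
    · intro Q
      dsimp only
      split_ifs with h
      · exact mul_nonneg hval.le (hw.1 _)
      · exact le_rfl
    · intro Q hQ
      exact dif_neg fun h => hQ ((hmem Q).1 h)
    · intro a
      refine le_trans (le_of_eq ?_) (hz a)
      simp only [G]
      rw [← Finset.sum_coe_sort N, Finset.mul_sum]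
      apply Finset.sum_congr rfl
      intro Q _
      simp
    · rw [← Finset.sum_coe_sort N]
      simp only [Finset.coe_mem, dite_true, Subtype.coe_eta]
      rw [← Finset.mul_sum, hw.2, mul_one]

/-- In a unit-capacity network, an s-t-flow `x` is strictly reroutable
iff `∑_{a ∈ C} (1 - x(a)) ≥ 1` for every t-separating cut `C = δ⁺(S)`. -/
theorem strictlyReroutable_iff_cut_slack_unit
    {V A : Type} [Fintype V] [DecidableEq V] [Fintype A] [DecidableEq A]
    (tl hd : A → V) (s t : V)
    (hδ : ∀ S : Finset V, S.Nonempty → t ∉ S → (outCut tl hd S).Nonempty)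
    (x : List A → ℝ) (hx : IsFlow tl hd s t (fun _ => (1 : ℝ)) x) :
    StrictlyReroutable tl hd s t (fun _ => (1 : ℝ)) x ↔
      ∀ S : Finset V, S.Nonempty → t ∉ S →
        1 ≤ ∑ a ∈ outCut tl hd S, (1 - arcFlow tl hd s t x a) := by
  classical
  obtain ⟨hx0, hx1, hx2⟩ := hx
  have hxnn : ∀ a, 0 ≤ arcFlow tl hd s t x a := by
    intro a
    unfold arcFlow
    rw [aux_sumOver]
    apply Finset.sum_nonneg
    intro Q _
    split_ifs
    · exact hx0 Q
    · exact le_rfl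
  constructor
  · intro h S hS htS
    obtain ⟨b, hb⟩ := hδ S hS htS
    obtain ⟨y, hy0, hy1, hy2, hy3⟩ := h b
    have hb' : tl b ∈ S ∧ hd b ∉ S := by simpa [outCut] using hb
    rw [← Finset.add_sum_erase _ _ hb]
    have key : arcFlow tl hd s t x b ≤
        ∑ a ∈ (outCut tl hd S).erase b, reArcFlow tl hd t b y a := by
      rw [← hy3]
      unfold reVal reArcFlow
      simp_rw [aux_sumOver]
      rw [Finset.sum_comm]
      apply Finset.sum_le_sum
      intro Q hQ
      have hQ : IsPath tl hd (tl b) t Q := by simpa using hQ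
      have hnn : ∀ a : A, 0 ≤ (if b ∉ Q ∧ a ∈ Q then y Q else 0) := by
        intro a
        split_ifs
        · exact hy0 Q
        · exact le_rfl
      by_cases hbQ : b ∈ Q
      · rw [if_neg (by simpa using hbQ)]
        exact Finset.sum_nonneg fun a _ => hnn a
      · obtain ⟨a, haQ, ha⟩ := aux_walk_cross tl hd t (S : Set V) (by simpa using htS) Q (tl b)
          (by simpa using hb'.1) hQ.1
        have hab : a ≠ b := by rintro rfl; exact hbQ haQ
        rw [if_pos hbQ]
        have hmem : a ∈ (outCut tl hd S).erase b := by
          rw [Finset.mem_erase]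
          exact ⟨hab, by simpa [outCut] using ha⟩
        refine le_trans (le_of_eq ?_) (Finset.single_le_sum (fun a _ => hnn a) hmem)
        rw [if_pos ⟨hbQ, haQ⟩]
    have h2 : ∑ a ∈ (outCut tl hd S).erase b, reArcFlow tl hd t b y a ≤
        ∑ a ∈ (outCut tl hd S).erase b, (1 - arcFlow tl hd s t x a) :=
      Finset.sum_le_sum fun a ha => hy2 a (Finset.ne_of_mem_erase ha)
    linarith
  · intro h b
    obtain ⟨y, hy0, hy1, hy2, hy3⟩ := aux_mfmc tl hd (tl b) t
      (fun a => if a = b then 0 else 1 - arcFlow tl hd s t x a)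
      (by
        intro a
        split_ifs
        · exact le_rfl
        · linarith [hx2 a])
      (arcFlow tl hd s t x b) (hxnn b) (by
        intro S hS htS
        have h1 := h S ⟨_, hS⟩ htS
        have h2 : ∑ a ∈ outCut tl hd S, (1 - arcFlow tl hd s t x a) ≤
            ∑ a ∈ outCut tl hd S, ((if a = b then 0 else 1 - arcFlow tl hd s t x a) +
              if a = b then 1 - arcFlow tl hd s t x b else 0) := by
          apply Finset.sum_le_sum
          intro a _
          split_ifs with hab
          · subst hab; simp
          · simp
        rw [Finset.sum_add_distrib] at h2
        have h3 : (∑ a ∈ outCut tl hd S, if a = b then 1 - arcFlow tl hd s t x b else 0) ≤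
            1 - arcFlow tl hd s t x b := by
          rw [Finset.sum_ite_eq']
          split_ifs
          · exact le_rfl
          · linarith [hx2 b]
        linarith)
    have hzero : ∀ Q, IsPath tl hd (tl b) t Q → b ∈ Q → y Q = 0 := by
      intro Q hQ hbQ
      have h1 := hy2 b
      rw [if_pos rfl] at h1
      have hnn : ∀ R ∈ (aux_finite tl hd (tl b) t).toFinset,
          0 ≤ (if b ∈ R then y R else 0) := by
        intro R _
        split_ifs
        · exact hy0 R
        · exact le_rfl
      have h2 := Finset.single_le_sum hnn (show Q ∈ _ by simpa using hQ)
      rw [if_pos hbQ] at h2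
      exact le_antisymm (h2.trans h1) (hy0 Q)
    refine ⟨y, hy0, ?_, ?_, ?_⟩
    · intro Q hQ
      by_cases hp : IsPath tl hd (tl b) t Q
      · exact hzero Q hp (by by_contra hb; exact hQ ⟨hp, hb⟩)
      · exact hy1 Q hp
    · intro a hab
      have h1 := hy2 a
      rw [if_neg hab] at h1
      refine le_trans (le_of_eq ?_) h1
      unfold reArcFlow
      rw [aux_sumOver]
      apply Finset.sum_congr rfl
      intro Q hQ
      have hQ : IsPath tl hd (tl b) t Q := by simpa using hQ
      by_cases hbQ : b ∈ Q
      · simp [hzero Q hQ hbQ]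
      · simp [hbQ]
    · rw [← hy3]
      unfold reVal
      rw [aux_sumOver]
      apply Finset.sum_congr rfl
      intro Q hQ
      have hQ : IsPath tl hd (tl b) t Q := by simpa using hQ
      by_cases hbQ : b ∈ Q
      · simp [hzero Q hQ hbQ]
      · simp [hbQ]
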